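/- One has the identity ⟨du_9, du_9⟩* = (14112/5) u_12 u_2^2 + (3192/5) u_9 u_5 u_2 + (1323/50) u_8^2 - (3528/25) u_8 u_6 u_2 - (128772/5) u_8 u_2^4 + (784/25) u_6^2 u_2^2 + (147/25) u_6 u_5^2 + (249312/5) u_6 u_2^5 - 4116 u_5^2 u_2^3 - (1555848/5) u_2^8 as polynomials in the six variables y. -/

import Mathlib

open MvPolynomial

noncomputable section

/-- `S6 = x₁ + ⋯ + x₆` inside the eight variables `x₁,…,x₈`. -/
def S6 : MvPolynomial (Fin 8) ℚ := X 0 + X 1 + X 2 + X 3 + X 4 + X 5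

/-- The `E₆`-invariant polynomial `U_m`. -/
def U (m : ℕ) : MvPolynomial (Fin 8) ℚ :=
  (∑ i ∈ Finset.univ.filter (fun i : Fin 8 => i.val < 6),
      ((C (1/2 : ℚ) * (X 6 - X 7) - X i + C (1/6 : ℚ) * S6) ^ m +
        (-(C (1/2 : ℚ) * (X 6 - X 7)) - X i + C (1/6 : ℚ) * S6) ^ m)) +
    ∑ p ∈ Finset.univ.filter (fun p : Fin 8 × Fin 8 => p.1.val < p.2.val ∧ p.2.val < 6),
      (X p.1 + X p.2 - C (1/3 : ℚ) * S6) ^ m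

/-- Restriction to the subspace `S6 = 0`, `x₇ + x₈ = 0`:
substitute `x₆ = -(x₁+⋯+x₅)` and `x₈ = -x₇`, with the remaining
variables `y = (x₁,…,x₅,x₇)`. -/
def subE6 : Fin 8 → MvPolynomial (Fin 6) ℚ :=
  ![X 0, X 1, X 2, X 3, X 4, -(X 0 + X 1 + X 2 + X 3 + X 4), X 5, -X 5]

/-- The basic invariants `u_m` in the six variables `y`, with `u₂ = U₂/12`. -/
def u (m : ℕ) : MvPolynomial (Fin 6) ℚ :=
  if m = 2 then C (1/12 : ℚ) * aeval subE6 (U 2) else aeval subE6 (U m)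

/-- The symmetric matrix `G` determined by `u₂(y) = ∑ᵢⱼ Gᵢⱼ yᵢ yⱼ`. -/
def GE6 : Matrix (Fin 6) (Fin 6) ℚ := fun i j =>
  if i = j then coeff (Finsupp.single i 2) (u 2)
  else (1/2) * coeff (Finsupp.single i 1 + Finsupp.single j 1) (u 2)

/-- The pairing `⟨dp, dq⟩* = ∑ᵢⱼ (∂p/∂yᵢ) (G⁻¹)ᵢⱼ (∂q/∂yⱼ)`. -/
def pairE6 (p q : MvPolynomial (Fin 6) ℚ) : MvPolynomial (Fin 6) ℚ :=
  ∑ i : Fin 6, ∑ j : Fin 6, C (GE6⁻¹ i j) * pderiv i p * pderiv j q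

/-- The sixth coordinate on the hyperplane. -/
abbrev w5 : MvPolynomial (Fin 6) ℚ := -(X 0 + X 1 + X 2 + X 3 + X 4)

/-- The 27-term power sum for arbitrary ring elements. -/
def V {R : Type*} [CommRing R] (a b c d e f t : R) (m : ℕ) : R :=
  ((t - a) ^ m + (-t - a) ^ m) + ((t - b) ^ m + (-t - b) ^ m) + ((t - c) ^ m + (-t - c) ^ m) +
  ((t - d) ^ m + (-t - d) ^ m) + ((t - e) ^ m + (-t - e) ^ m) + ((t - f) ^ m + (-t - f) ^ m) +
  ((a + b) ^ m + (a + c) ^ m + (a + d) ^ m + (a + e) ^ m + (a + f) ^ m +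
   (b + c) ^ m + (b + d) ^ m + (b + e) ^ m + (b + f) ^ m +
   (c + d) ^ m + (c + e) ^ m + (c + f) ^ m + (d + e) ^ m + (d + f) ^ m + (e + f) ^ m)

lemma half_sub_E6 : (C (1/2 : ℚ) * (X 5 - -X 5) : MvPolynomial (Fin 6) ℚ) = X 5 := by
  have h : (C (1/2 : ℚ) * 2 : MvPolynomial (Fin 6) ℚ) = 1 := by
    rw [← map_ofNat (C : ℚ →+* MvPolynomial (Fin 6) ℚ) 2, ← C_mul]; norm_num
  linear_combination (X 5 : MvPolynomial (Fin 6) ℚ) * h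

lemma aeval_S6 : aeval subE6 S6 = 0 := by
  simp [S6, subE6]

lemma aeval_U (m : ℕ) : aeval subE6 (U m) =
    V (X 0) (X 1) (X 2) (X 3) (X 4) w5 (X 5) m := by
  have h1 : (Finset.univ.filter (fun i : Fin 8 => i.val < 6)) = {0,1,2,3,4,5} := by decide
  have h2 : (Finset.univ.filter (fun p : Fin 8 × Fin 8 => p.1.val < p.2.val ∧ p.2.val < 6)) =
    {(0,1),(0,2),(0,3),(0,4),(0,5),(1,2),(1,3),(1,4),(1,5),(2,3),(2,4),(2,5),(3,4),(3,5),(4,5)} := by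
    decide
  have hC : ∀ q : ℚ, aeval subE6 (C q) = C q := fun q => by simp [algebraMap_eq]
  have s0 : subE6 0 = X 0 := rfl
  have s1 : subE6 1 = X 1 := rfl
  have s2 : subE6 2 = X 2 := rfl
  have s3 : subE6 3 = X 3 := rfl
  have s4 : subE6 4 = X 4 := rfl
  have s5 : subE6 5 = w5 := rfl
  have s6 : subE6 6 = X 5 := rfl
  have s7 : subE6 7 = -X 5 := rfl
  rw [U, h1, h2]
  simp only [map_add, map_sum, map_pow, map_sub, map_neg, map_mul, hC, aeval_X, aeval_S6,
    s6, s7, half_sub_E6, mul_zero, add_zero, sub_zero]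
  repeat rw [Finset.sum_insert (by decide)]
  simp only [Finset.sum_singleton, s0, s1, s2, s3, s4, s5, V]
  ring

lemma u_ne (m : ℕ) (h : m ≠ 2) : u m = V (X 0) (X 1) (X 2) (X 3) (X 4) w5 (X 5) m := by
  rw [u, if_neg h, aeval_U]

lemma u_two : u 2 = X 5 ^ 2 + (C (1/2 : ℚ)) * (X 0 ^ 2 + X 1 ^ 2 + X 2 ^ 2 + X 3 ^ 2 + X 4 ^ 2
    + w5 ^ 2) := by
  have h : (C (1/12 : ℚ) * 12 : MvPolynomial (Fin 6) ℚ) = 1 := by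
    rw [← map_ofNat (C : ℚ →+* MvPolynomial (Fin 6) ℚ) 12, ← C_mul]; norm_num
  have h' : (C (1/12 : ℚ) * 6 : MvPolynomial (Fin 6) ℚ) = C (1/2) := by
    rw [← map_ofNat (C : ℚ →+* MvPolynomial (Fin 6) ℚ) 6, ← C_mul]; norm_num
  rw [u, if_pos rfl, aeval_U, V, ← h']
  linear_combination (X 5 ^ 2 : MvPolynomial (Fin 6) ℚ) * h

/-- The Gram matrix. -/
def Gm : Matrix (Fin 6) (Fin 6) ℚ :=
  !![1, 1/2, 1/2, 1/2, 1/2, 0; 1/2, 1, 1/2, 1/2, 1/2, 0; 1/2, 1/2, 1, 1/2, 1/2, 0;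
     1/2, 1/2, 1/2, 1, 1/2, 0; 1/2, 1/2, 1/2, 1/2, 1, 0; 0, 0, 0, 0, 0, 1]

/-- Its inverse. -/
def Gi : Matrix (Fin 6) (Fin 6) ℚ :=
  !![5/3, -1/3, -1/3, -1/3, -1/3, 0; -1/3, 5/3, -1/3, -1/3, -1/3, 0;
     -1/3, -1/3, 5/3, -1/3, -1/3, 0; -1/3, -1/3, -1/3, 5/3, -1/3, 0;
     -1/3, -1/3, -1/3, -1/3, 5/3, 0; 0, 0, 0, 0, 0, 1]

lemma Gm_mul_Gi : Gm * Gi = 1 := by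
  ext i j
  fin_cases i <;> fin_cases j <;>
    simp [Gm, Gi, Matrix.mul_apply, Fin.sum_univ_succ] <;> norm_num

lemma u_two_sum : u 2 = ∑ k : Fin 6, ∑ l : Fin 6,
    monomial (Finsupp.single k 1 + Finsupp.single l 1) (Gm k l) := by
  have hm : ∀ (k l : Fin 6) (q : ℚ), monomial (Finsupp.single k 1 + Finsupp.single l 1) q =
      C q * (X k * X l) := by
    intro k l q
    rw [X, X, monomial_mul, C_mul_monomial]; simp
  rw [u_two]
  simp only [hm]
  have h : (C (1/2 : ℚ) * 2 : MvPolynomial (Fin 6) ℚ) = 1 := by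
    rw [← map_ofNat (C : ℚ →+* MvPolynomial (Fin 6) ℚ) 2, ← C_mul]; norm_num
  simp only [Fin.sum_univ_six]
  simp only [Gm, Matrix.of_apply, Matrix.cons_val, map_zero, map_one]
  linear_combination (X 0 ^ 2 + X 1 ^ 2 + X 2 ^ 2 + X 3 ^ 2 + X 4 ^ 2 : MvPolynomial (Fin 6) ℚ) * h

lemma single_eq (k l i j : Fin 6) :
    ((Finsupp.single k 1 + Finsupp.single l 1 : Fin 6 →₀ ℕ) =
      Finsupp.single i 1 + Finsupp.single j 1) ↔ ((k = i ∧ l = j) ∨ (k = j ∧ l = i)) := by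
  constructor
  · intro h
    have h2 : ∀ a, (if k = a then 1 else 0) + (if l = a then 1 else 0) =
        (if i = a then 1 else 0) + (if j = a then (1:ℕ) else 0) := by
      intro a
      have := DFunLike.congr_fun h a
      simpa [Finsupp.single_apply] using this
    have hk := h2 k
    have hl := h2 l
    have hi := h2 i
    have hj := h2 j
    clear h h2
    grind
  · rintro (⟨rfl, rfl⟩ | ⟨rfl, rfl⟩)
    · rfl
    · rw [add_comm]

lemma Gm_symm (i j : Fin 6) : Gm i j = Gm j i := by
  fin_cases i <;> fin_cases j <;> rfl

lemma GE6_eq : GE6 = Gm := by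
  have hs : ∀ i : Fin 6, Finsupp.single i 2 = Finsupp.single i 1 + Finsupp.single i 1 := by
    intro i; rw [← Finsupp.single_add]
  have hc : ∀ i j : Fin 6, coeff (Finsupp.single i 1 + Finsupp.single j 1) (u 2) =
      ∑ k : Fin 6, ∑ l : Fin 6, if (k = i ∧ l = j) ∨ (k = j ∧ l = i) then Gm k l else 0 := by
    intro i j
    rw [u_two_sum]
    simp only [coeff_sum, coeff_monomial, single_eq]
  ext i j
  simp only [GE6, hs, hc]
  by_cases hij : i = j
  · subst hij
    simp [ite_and]
  · have hor : ∀ k l : Fin 6, (if k = i ∧ l = j ∨ k = j ∧ l = i then Gm k l else 0) =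
        (if k = i ∧ l = j then Gm k l else 0) + (if k = j ∧ l = i then Gm k l else 0) := by
      intro k l
      grind
    rw [if_neg hij]
    simp only [hor, Finset.sum_add_distrib]
    simp only [ite_and, Finset.sum_ite_irrel, Finset.sum_const_zero, Finset.sum_ite_eq',
      Finset.mem_univ, if_true]
    linear_combination (1/2) * Gm_symm j i

lemma GE6_inv : GE6⁻¹ = Gi := by
  rw [GE6_eq]; exact Matrix.inv_eq_right_inv Gm_mul_Gi

/-- Partial derivative (up to a factor) of the 27-term sum of 9th powers. -/
def Dx {R : Type*} [CommRing R] (x a b c d e t : R) : R :=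
  9 * (-(t - x) ^ 8 - (-t - x) ^ 8 + (x + a) ^ 8 + (x + b) ^ 8 + (x + c) ^ 8 + (x + d) ^ 8
    + (x + e) ^ 8)

/-- Partial derivative in the last variable. -/
def Dt {R : Type*} [CommRing R] (a b c d e f t : R) : R :=
  9 * (((t - a) ^ 8 - (-t - a) ^ 8) + ((t - b) ^ 8 - (-t - b) ^ 8) + ((t - c) ^ 8 - (-t - c) ^ 8) +
  ((t - d) ^ 8 - (-t - d) ^ 8) + ((t - e) ^ 8 - (-t - e) ^ 8) + ((t - f) ^ 8 - (-t - f) ^ 8))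

section
variable (y : Fin 6 → ℚ)

lemma eval_u (m : ℕ) (h : m ≠ 2) : eval y (u m) =
    V (y 0) (y 1) (y 2) (y 3) (y 4) (-(y 0 + y 1 + y 2 + y 3 + y 4)) (y 5) m := by
  rw [u_ne m h]; simp [V]

lemma eval_u_two : eval y (u 2) = y 5 ^ 2 + (1/2) * (y 0 ^ 2 + y 1 ^ 2 + y 2 ^ 2 + y 3 ^ 2 + y 4 ^ 2
    + (-(y 0 + y 1 + y 2 + y 3 + y 4)) ^ 2) := by
  rw [u_two]; simp

lemma D_pow (D : Derivation ℚ (MvPolynomial (Fin 6) ℚ) (MvPolynomial (Fin 6) ℚ))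
    (z : MvPolynomial (Fin 6) ℚ) : D (z ^ 9) = 9 * z ^ 8 * D z := by
  rw [Derivation.leibniz_pow]
  simp [mul_assoc]

lemma D_V (D : Derivation ℚ (MvPolynomial (Fin 6) ℚ) (MvPolynomial (Fin 6) ℚ))
    (a b c d e f t : MvPolynomial (Fin 6) ℚ) : D (V a b c d e f t 9) =
      Dx a b c d e f t * D a + Dx b a c d e f t * D b + Dx c a b d e f t * D c + Dx d a b c e f t * D d + Dx e a b c d f t * D e + Dx f a b c d e t * D f +
      Dt a b c d e f t * D t := by
  simp only [V, Dx, Dt, map_add, D_pow, map_sub, map_neg]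
  rw [add_comm b a]
  rw [add_comm c a]
  rw [add_comm d a]
  rw [add_comm e a]
  rw [add_comm f a]
  rw [add_comm c b]
  rw [add_comm d b]
  rw [add_comm e b]
  rw [add_comm f b]
  rw [add_comm d c]
  rw [add_comm e c]
  rw [add_comm f c]
  rw [add_comm e d]
  rw [add_comm f d]
  rw [add_comm f e]
  generalize (t - a) ^ 8 = r0
  generalize (t - b) ^ 8 = r1
  generalize (t - c) ^ 8 = r2
  generalize (t - d) ^ 8 = r3
  generalize (t - e) ^ 8 = r4
  generalize (t - f) ^ 8 = r5
  generalize (-t - a) ^ 8 = r6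
  generalize (-t - b) ^ 8 = r7
  generalize (-t - c) ^ 8 = r8
  generalize (-t - d) ^ 8 = r9
  generalize (-t - e) ^ 8 = r10
  generalize (-t - f) ^ 8 = r11
  generalize (a + b) ^ 8 = r12
  generalize (a + c) ^ 8 = r13
  generalize (a + d) ^ 8 = r14
  generalize (a + e) ^ 8 = r15
  generalize (a + f) ^ 8 = r16
  generalize (b + c) ^ 8 = r17
  generalize (b + d) ^ 8 = r18
  generalize (b + e) ^ 8 = r19
  generalize (b + f) ^ 8 = r20
  generalize (c + d) ^ 8 = r21
  generalize (c + e) ^ 8 = r22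
  generalize (c + f) ^ 8 = r23
  generalize (d + e) ^ 8 = r24
  generalize (d + f) ^ 8 = r25
  generalize (e + f) ^ 8 = r26
  ring

lemma pd0 : pderiv 0 (u 9) = Dx (X 0) (X 1) (X 2) (X 3) (X 4) w5 (X 5) -
    Dx w5 (X 0) (X 1) (X 2) (X 3) (X 4) (X 5) := by
  rw [u_ne 9 (by norm_num), D_V]
  simp [pderiv_X, sub_eq_add_neg]

lemma pd1 : pderiv 1 (u 9) = Dx (X 1) (X 0) (X 2) (X 3) (X 4) w5 (X 5) -
    Dx w5 (X 0) (X 1) (X 2) (X 3) (X 4) (X 5) := by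
  rw [u_ne 9 (by norm_num), D_V]
  simp [pderiv_X, sub_eq_add_neg]

lemma pd2 : pderiv 2 (u 9) = Dx (X 2) (X 0) (X 1) (X 3) (X 4) w5 (X 5) -
    Dx w5 (X 0) (X 1) (X 2) (X 3) (X 4) (X 5) := by
  rw [u_ne 9 (by norm_num), D_V]
  simp [pderiv_X, sub_eq_add_neg]

lemma pd3 : pderiv 3 (u 9) = Dx (X 3) (X 0) (X 1) (X 2) (X 4) w5 (X 5) -
    Dx w5 (X 0) (X 1) (X 2) (X 3) (X 4) (X 5) := by
  rw [u_ne 9 (by norm_num), D_V]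
  simp [pderiv_X, sub_eq_add_neg]

lemma pd4 : pderiv 4 (u 9) = Dx (X 4) (X 0) (X 1) (X 2) (X 3) w5 (X 5) -
    Dx w5 (X 0) (X 1) (X 2) (X 3) (X 4) (X 5) := by
  rw [u_ne 9 (by norm_num), D_V]
  simp [pderiv_X, sub_eq_add_neg]

lemma pd5 : pderiv 5 (u 9) = Dt (X 0) (X 1) (X 2) (X 3) (X 4) w5 (X 5) := by
  rw [u_ne 9 (by norm_num), D_V]
  simp [pderiv_X]

end

lemma eval_Dx (y : Fin 6 → ℚ) (x a b c d e t : MvPolynomial (Fin 6) ℚ) :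
    eval y (Dx x a b c d e t) = Dx (eval y x) (eval y a) (eval y b) (eval y c) (eval y d)
      (eval y e) (eval y t) := by
  simp [Dx]

lemma eval_Dt (y : Fin 6 → ℚ) (x a b c d e t : MvPolynomial (Fin 6) ℚ) :
    eval y (Dt x a b c d e t) = Dt (eval y x) (eval y a) (eval y b) (eval y c) (eval y d)
      (eval y e) (eval y t) := by
  simp [Dt]

lemma eval_pair (y : Fin 6 → ℚ) (p : MvPolynomial (Fin 6) ℚ) (d0 d1 d2 d3 d4 d5 dt : ℚ)
    (h0 : eval y (pderiv 0 p) = d0 - d5) (h1 : eval y (pderiv 1 p) = d1 - d5)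
    (h2 : eval y (pderiv 2 p) = d2 - d5) (h3 : eval y (pderiv 3 p) = d3 - d5)
    (h4 : eval y (pderiv 4 p) = d4 - d5) (h5 : eval y (pderiv 5 p) = dt) :
    eval y (pairE6 p p) = 2 * (d0 ^ 2 + d1 ^ 2 + d2 ^ 2 + d3 ^ 2 + d4 ^ 2 + d5 ^ 2) -
      (d0 + d1 + d2 + d3 + d4 + d5) ^ 2 / 3 + dt ^ 2 := by
  simp only [pairE6, GE6_inv, map_add, map_mul, eval_C, Fin.sum_univ_six, h0, h1, h2, h3, h4, h5]
  simp only [Gi, Matrix.of_apply, Matrix.cons_val]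
  ring

/-- Power sums. -/
def P (a b c d e f : ℚ) (k : ℕ) : ℚ := a ^ k + b ^ k + c ^ k + d ^ k + e ^ k + f ^ k

/-- The six numbers have elementary symmetric functions `0, e2, ..., e6`. -/
structure IsEl (a b c d e f e2 e3 e4 e5 e6 : ℚ) : Prop where
  h1 : a + b + c + d + e + f = 0
  h2 : e2 = a*b+a*c+a*d+a*e+a*f+b*c+b*d+b*e+b*f+c*d+c*e+c*f+d*e+d*f+e*f
  h3 : e3 = a*b*c+a*b*d+a*b*e+a*b*f+a*c*d+a*c*e+a*c*f+a*d*e+a*d*f+a*e*f+b*c*d+b*c*e+b*c*f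
    +b*d*e+b*d*f+b*e*f+c*d*e+c*d*f+c*e*f+d*e*f
  h4 : e4 = a*b*c*d+a*b*c*e+a*b*c*f+a*b*d*e+a*b*d*f+a*b*e*f+a*c*d*e+a*c*d*f+a*c*e*f+a*d*e*f
    +b*c*d*e+b*c*d*f+b*c*e*f+b*d*e*f+c*d*e*f
  h5 : e5 = a*b*c*d*e+a*b*c*d*f+a*b*c*e*f+a*b*d*e*f+a*c*d*e*f+b*c*d*e*f
  h6 : e6 = a*b*c*d*e*f

lemma poly_root {a b c d e f e2 e3 e4 e5 e6 : ℚ} (h : IsEl a b c d e f e2 e3 e4 e5 e6) (x : ℚ) :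
    x ^ 6 + e2 * x ^ 4 - e3 * x ^ 3 + e4 * x ^ 2 - e5 * x + e6 =
      (x - a) * (x - b) * (x - c) * (x - d) * (x - e) * (x - f) := by
  rw [h.h2, h.h3, h.h4, h.h5, h.h6]
  linear_combination x ^ 5 * h.h1

lemma newton {a b c d e f e2 e3 e4 e5 e6 : ℚ} (h : IsEl a b c d e f e2 e3 e4 e5 e6) (k : ℕ) :
    P a b c d e f (k + 6) = -e2 * P a b c d e f (k + 4) + e3 * P a b c d e f (k + 3)
      - e4 * P a b c d e f (k + 2) + e5 * P a b c d e f (k + 1) - e6 * P a b c d e f k := by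
  have ha : a ^ 6 + e2 * a ^ 4 - e3 * a ^ 3 + e4 * a ^ 2 - e5 * a + e6 = 0 := (poly_root h a).trans (by ring)
  have hb : b ^ 6 + e2 * b ^ 4 - e3 * b ^ 3 + e4 * b ^ 2 - e5 * b + e6 = 0 := (poly_root h b).trans (by ring)
  have hc : c ^ 6 + e2 * c ^ 4 - e3 * c ^ 3 + e4 * c ^ 2 - e5 * c + e6 = 0 := (poly_root h c).trans (by ring)
  have hd : d ^ 6 + e2 * d ^ 4 - e3 * d ^ 3 + e4 * d ^ 2 - e5 * d + e6 = 0 := (poly_root h d).trans (by ring)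
  have he : e ^ 6 + e2 * e ^ 4 - e3 * e ^ 3 + e4 * e ^ 2 - e5 * e + e6 = 0 := (poly_root h e).trans (by ring)
  have hf : f ^ 6 + e2 * f ^ 4 - e3 * f ^ 3 + e4 * f ^ 2 - e5 * f + e6 = 0 := (poly_root h f).trans (by ring)
  simp only [P]
  linear_combination a ^ k * ha + b ^ k * hb + c ^ k * hc + d ^ k * hd + e ^ k * he + f ^ k * hf

lemma P_0 (a b c d e f : ℚ) : P a b c d e f 0 = 6 := by
  simp only [P]; norm_num

lemma P_1 {a b c d e f e2 e3 e4 e5 e6 : ℚ} (h : IsEl a b c d e f e2 e3 e4 e5 e6) :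
    P a b c d e f 1 = 0 := by
  simp only [P]; linear_combination h.h1

lemma P_2 {a b c d e f e2 e3 e4 e5 e6 : ℚ} (h : IsEl a b c d e f e2 e3 e4 e5 e6) :
    P a b c d e f 2 = -2 * e2 := by
  have hf : f = -(a + b + c + d + e) := by linear_combination h.h1
  rw [h.h2, hf]; simp only [P]; ring

lemma P_3 {a b c d e f e2 e3 e4 e5 e6 : ℚ} (h : IsEl a b c d e f e2 e3 e4 e5 e6) :
    P a b c d e f 3 = 3 * e3 := by
  have hf : f = -(a + b + c + d + e) := by linear_combination h.h1
  rw [h.h3, hf]; simp only [P]; ring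

lemma P_4 {a b c d e f e2 e3 e4 e5 e6 : ℚ} (h : IsEl a b c d e f e2 e3 e4 e5 e6) :
    P a b c d e f 4 = -4 * e4 + 2 * e2 ^ 2 := by
  have hf : f = -(a + b + c + d + e) := by linear_combination h.h1
  rw [h.h2, h.h4, hf]; simp only [P]; ring

lemma P_5 {a b c d e f e2 e3 e4 e5 e6 : ℚ} (h : IsEl a b c d e f e2 e3 e4 e5 e6) :
    P a b c d e f 5 = 5 * e5 - 5 * e2 * e3 := by
  have hf : f = -(a + b + c + d + e) := by linear_combination h.h1
  rw [h.h2, h.h3, h.h5, hf]; simp only [P]; ring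

lemma P_6 {a b c d e f e2 e3 e4 e5 e6 : ℚ} (h : IsEl a b c d e f e2 e3 e4 e5 e6) :
    P a b c d e f 6 =
      -6 * e6 + 3 * e3 ^ 2 + 6 * e2 * e4 - 2 * e2 ^ 3 := by
  rw [newton h 0];
  rw [P_0, P_1 h, P_2 h, P_3 h, P_4 h]; ring

lemma P_7 {a b c d e f e2 e3 e4 e5 e6 : ℚ} (h : IsEl a b c d e f e2 e3 e4 e5 e6) :
    P a b c d e f 7 =
      -7 * e3 * e4 - 7 * e2 * e5 + 7 * e2 ^ 2 * e3 := by
  rw [newton h 1];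
  rw [P_1 h, P_2 h, P_3 h, P_4 h, P_5 h]; ring

lemma P_8 {a b c d e f e2 e3 e4 e5 e6 : ℚ} (h : IsEl a b c d e f e2 e3 e4 e5 e6) :
    P a b c d e f 8 =
      4 * e4 ^ 2 + 8 * e3 * e5 + 8 * e2 * e6 - 8 * e2 * e3 ^ 2 - 8 * e2 ^ 2 * e4 + 2 * e2 ^ 4 := by
  rw [newton h 2];
  rw [P_2 h, P_3 h, P_4 h, P_5 h, P_6 h]; ring

lemma P_9 {a b c d e f e2 e3 e4 e5 e6 : ℚ} (h : IsEl a b c d e f e2 e3 e4 e5 e6) :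
    P a b c d e f 9 =
      -9 * e4 * e5 - 9 * e3 * e6 + 3 * e3 ^ 3 + 18 * e2 * e3 * e4 + 9 * e2 ^ 2 * e5 - 9 * e2 ^ 3 * e3 := by
  rw [newton h 3];
  rw [P_3 h, P_4 h, P_5 h, P_6 h, P_7 h]; ring

lemma P_10 {a b c d e f e2 e3 e4 e5 e6 : ℚ} (h : IsEl a b c d e f e2 e3 e4 e5 e6) :
    P a b c d e f 10 =
      5 * e5 ^ 2 + 10 * e4 * e6 - 10 * e3 ^ 2 * e4 - 10 * e2 * e4 ^ 2 - 20 * e2 * e3 * e5 - 10 * e2 ^ 2 * e6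
      + 15 * e2 ^ 2 * e3 ^ 2 + 10 * e2 ^ 3 * e4 - 2 * e2 ^ 5 := by
  rw [newton h 4];
  rw [P_4 h, P_5 h, P_6 h, P_7 h, P_8 h]; ring

lemma P_11 {a b c d e f e2 e3 e4 e5 e6 : ℚ} (h : IsEl a b c d e f e2 e3 e4 e5 e6) :
    P a b c d e f 11 =
      -11 * e5 * e6 + 11 * e3 * e4 ^ 2 + 11 * e3 ^ 2 * e5 + 22 * e2 * e4 * e5 + 22 * e2 * e3 * e6
      - 11 * e2 * e3 ^ 3 - 33 * e2 ^ 2 * e3 * e4 - 11 * e2 ^ 3 * e5 + 11 * e2 ^ 4 * e3 := by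
  rw [newton h 5];
  rw [P_5 h, P_6 h, P_7 h, P_8 h, P_9 h]; ring

lemma P_12 {a b c d e f e2 e3 e4 e5 e6 : ℚ} (h : IsEl a b c d e f e2 e3 e4 e5 e6) :
    P a b c d e f 12 =
      6 * e6 ^ 2 - 4 * e4 ^ 3 - 24 * e3 * e4 * e5 - 12 * e3 ^ 2 * e6 + 3 * e3 ^ 4 - 12 * e2 * e5 ^ 2
      - 24 * e2 * e4 * e6 + 36 * e2 * e3 ^ 2 * e4 + 18 * e2 ^ 2 * e4 ^ 2 + 36 * e2 ^ 2 * e3 * e5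
      + 12 * e2 ^ 3 * e6 - 24 * e2 ^ 3 * e3 ^ 2 - 12 * e2 ^ 4 * e4 + 2 * e2 ^ 6 := by
  rw [newton h 6];
  rw [P_6 h, P_7 h, P_8 h, P_9 h, P_10 h]; ring

lemma V_P5 (a b c d e f t : ℚ) : V a b c d e f t 5 =
      (-10) * (P a b c d e f 1 * t ^ 4) +
      (-20) * (P a b c d e f 3 * t ^ 2) +
      (-2) * (P a b c d e f 5 * t ^ 0) +
      1 / 2 * (P a b c d e f 0 * P a b c d e f 5) +
      5 / 2 * (P a b c d e f 1 * P a b c d e f 4) +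
      10 / 2 * (P a b c d e f 2 * P a b c d e f 3) +
      10 / 2 * (P a b c d e f 3 * P a b c d e f 2) +
      5 / 2 * (P a b c d e f 4 * P a b c d e f 1) +
      1 / 2 * (P a b c d e f 5 * P a b c d e f 0) -
      16 * P a b c d e f 5 := by
  simp only [V, P]; ring

lemma V_5 {a b c d e f e2 e3 e4 e5 e6 : ℚ} (h : IsEl a b c d e f e2 e3 e4 e5 e6) (t : ℚ) :
    V a b c d e f t 5 =
      -60 * e5 - 60 * e3 * t ^ 2 := by
  rw [V_P5]; simp only [P_0, P_1 h, P_2 h, P_3 h, P_4 h, P_5 h]; ring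

lemma V_P6 (a b c d e f t : ℚ) : V a b c d e f t 6 =
      (2) * (P a b c d e f 0 * t ^ 6) +
      (30) * (P a b c d e f 2 * t ^ 4) +
      (30) * (P a b c d e f 4 * t ^ 2) +
      (2) * (P a b c d e f 6 * t ^ 0) +
      1 / 2 * (P a b c d e f 0 * P a b c d e f 6) +
      6 / 2 * (P a b c d e f 1 * P a b c d e f 5) +
      15 / 2 * (P a b c d e f 2 * P a b c d e f 4) +
      20 / 2 * (P a b c d e f 3 * P a b c d e f 3) +
      15 / 2 * (P a b c d e f 4 * P a b c d e f 2) +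
      6 / 2 * (P a b c d e f 5 * P a b c d e f 1) +
      1 / 2 * (P a b c d e f 6 * P a b c d e f 0) -
      32 * P a b c d e f 6 := by
  simp only [V, P]; ring

lemma V_6 {a b c d e f e2 e3 e4 e5 e6 : ℚ} (h : IsEl a b c d e f e2 e3 e4 e5 e6) (t : ℚ) :
    V a b c d e f t 6 =
      12 * t ^ 6 + 144 * e6 - 120 * e4 * t ^ 2 + 18 * e3 ^ 2 - 60 * e2 * t ^ 4 - 24 * e2 * e4
      + 60 * e2 ^ 2 * t ^ 2 - 12 * e2 ^ 3 := by
  rw [V_P6]; simp only [P_0, P_1 h, P_2 h, P_3 h, P_4 h, P_5 h, P_6 h]; ring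

lemma V_P8 (a b c d e f t : ℚ) : V a b c d e f t 8 =
      (2) * (P a b c d e f 0 * t ^ 8) +
      (56) * (P a b c d e f 2 * t ^ 6) +
      (140) * (P a b c d e f 4 * t ^ 4) +
      (56) * (P a b c d e f 6 * t ^ 2) +
      (2) * (P a b c d e f 8 * t ^ 0) +
      1 / 2 * (P a b c d e f 0 * P a b c d e f 8) +
      8 / 2 * (P a b c d e f 1 * P a b c d e f 7) +
      28 / 2 * (P a b c d e f 2 * P a b c d e f 6) +
      56 / 2 * (P a b c d e f 3 * P a b c d e f 5) +
      70 / 2 * (P a b c d e f 4 * P a b c d e f 4) +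
      56 / 2 * (P a b c d e f 5 * P a b c d e f 3) +
      28 / 2 * (P a b c d e f 6 * P a b c d e f 2) +
      8 / 2 * (P a b c d e f 7 * P a b c d e f 1) +
      1 / 2 * (P a b c d e f 8 * P a b c d e f 0) -
      128 * P a b c d e f 8 := by
  simp only [V, P]; ring

lemma V_8 {a b c d e f e2 e3 e4 e5 e6 : ℚ} (h : IsEl a b c d e f e2 e3 e4 e5 e6) (t : ℚ) :
    V a b c d e f t 8 =
      12 * t ^ 8 - 336 * e6 * t ^ 2 - 560 * e4 * t ^ 4 + 80 * e4 ^ 2 - 120 * e3 * e5 + 168 * e3 ^ 2 * t ^ 2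
      - 112 * e2 * t ^ 6 - 624 * e2 * e6 + 336 * e2 * e4 * t ^ 2 - 48 * e2 * e3 ^ 2 + 280 * e2 ^ 2 * t ^ 4
      + 64 * e2 ^ 2 * e4 - 112 * e2 ^ 3 * t ^ 2 + 12 * e2 ^ 4 := by
  rw [V_P8]; simp only [P_0, P_1 h, P_2 h, P_3 h, P_4 h, P_5 h, P_6 h, P_7 h, P_8 h]; ring

lemma V_P9 (a b c d e f t : ℚ) : V a b c d e f t 9 =
      (-18) * (P a b c d e f 1 * t ^ 8) +
      (-168) * (P a b c d e f 3 * t ^ 6) +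
      (-252) * (P a b c d e f 5 * t ^ 4) +
      (-72) * (P a b c d e f 7 * t ^ 2) +
      (-2) * (P a b c d e f 9 * t ^ 0) +
      1 / 2 * (P a b c d e f 0 * P a b c d e f 9) +
      9 / 2 * (P a b c d e f 1 * P a b c d e f 8) +
      36 / 2 * (P a b c d e f 2 * P a b c d e f 7) +
      84 / 2 * (P a b c d e f 3 * P a b c d e f 6) +
      126 / 2 * (P a b c d e f 4 * P a b c d e f 5) +
      126 / 2 * (P a b c d e f 5 * P a b c d e f 4) +
      84 / 2 * (P a b c d e f 6 * P a b c d e f 3) +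
      36 / 2 * (P a b c d e f 7 * P a b c d e f 2) +
      9 / 2 * (P a b c d e f 8 * P a b c d e f 1) +
      1 / 2 * (P a b c d e f 9 * P a b c d e f 0) -
      256 * P a b c d e f 9 := by
  simp only [V, P]; ring

lemma V_9 {a b c d e f e2 e3 e4 e5 e6 : ℚ} (h : IsEl a b c d e f e2 e3 e4 e5 e6) (t : ℚ) :
    V a b c d e f t 9 =
      -1260 * e5 * t ^ 4 - 252 * e4 * e5 - 504 * e3 * t ^ 6 + 756 * e3 * e6 + 504 * e3 * e4 * t ^ 2
      + 504 * e2 * e5 * t ^ 2 + 1260 * e2 * e3 * t ^ 4 - 504 * e2 ^ 2 * e5 - 504 * e2 ^ 2 * e3 * t ^ 2 := by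
  rw [V_P9]; simp only [P_0, P_1 h, P_2 h, P_3 h, P_4 h, P_5 h, P_6 h, P_7 h, P_8 h, P_9 h]; ring

lemma V_P12 (a b c d e f t : ℚ) : V a b c d e f t 12 =
      (2) * (P a b c d e f 0 * t ^ 12) +
      (132) * (P a b c d e f 2 * t ^ 10) +
      (990) * (P a b c d e f 4 * t ^ 8) +
      (1848) * (P a b c d e f 6 * t ^ 6) +
      (990) * (P a b c d e f 8 * t ^ 4) +
      (132) * (P a b c d e f 10 * t ^ 2) +
      (2) * (P a b c d e f 12 * t ^ 0) +
      1 / 2 * (P a b c d e f 0 * P a b c d e f 12) +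
      12 / 2 * (P a b c d e f 1 * P a b c d e f 11) +
      66 / 2 * (P a b c d e f 2 * P a b c d e f 10) +
      220 / 2 * (P a b c d e f 3 * P a b c d e f 9) +
      495 / 2 * (P a b c d e f 4 * P a b c d e f 8) +
      792 / 2 * (P a b c d e f 5 * P a b c d e f 7) +
      924 / 2 * (P a b c d e f 6 * P a b c d e f 6) +
      792 / 2 * (P a b c d e f 7 * P a b c d e f 5) +
      495 / 2 * (P a b c d e f 8 * P a b c d e f 4) +
      220 / 2 * (P a b c d e f 9 * P a b c d e f 3) +
      66 / 2 * (P a b c d e f 10 * P a b c d e f 2) +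
      12 / 2 * (P a b c d e f 11 * P a b c d e f 1) +
      1 / 2 * (P a b c d e f 12 * P a b c d e f 0) -
      2048 * P a b c d e f 12 := by
  simp only [V, P]; ring

lemma V_12 {a b c d e f e2 e3 e4 e5 e6 : ℚ} (h : IsEl a b c d e f e2 e3 e4 e5 e6) (t : ℚ) :
    V a b c d e f t 12 =
      12 * t ^ 12 - 11088 * e6 * t ^ 6 + 4392 * e6 ^ 2 + 660 * e5 ^ 2 * t ^ 2 - 3960 * e4 * t ^ 8
      + 1320 * e4 * e6 * t ^ 2 + 3960 * e4 ^ 2 * t ^ 4 + 240 * e4 ^ 3 + 7920 * e3 * e5 * t ^ 4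
      - 540 * e3 * e4 * e5 + 5544 * e3 ^ 2 * t ^ 6 + 1908 * e3 ^ 2 * e6 - 1320 * e3 ^ 2 * e4 * t ^ 2
      + 18 * e3 ^ 4 - 264 * e2 * t ^ 10 + 7920 * e2 * e6 * t ^ 4 - 3900 * e2 * e5 ^ 2 + 11088 * e2 * e4 * t ^ 6
      - 1464 * e2 * e4 * e6 - 1320 * e2 * e4 ^ 2 * t ^ 2 - 2640 * e2 * e3 * e5 * t ^ 2 - 7920 * e2 * e3 ^ 2 * t ^ 4
      - 48 * e2 * e3 ^ 2 * e4 + 1980 * e2 ^ 2 * t ^ 8 - 1320 * e2 ^ 2 * e6 * t ^ 2 - 7920 * e2 ^ 2 * e4 * t ^ 4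
      + 1032 * e2 ^ 2 * e4 ^ 2 - 1500 * e2 ^ 2 * e3 * e5 + 1980 * e2 ^ 2 * e3 ^ 2 * t ^ 2 - 3696 * e2 ^ 3 * t ^ 6
      - 4152 * e2 ^ 3 * e6 + 1320 * e2 ^ 3 * e4 * t ^ 2 - 144 * e2 ^ 3 * e3 ^ 2 + 1980 * e2 ^ 4 * t ^ 4
      + 192 * e2 ^ 4 * e4 - 264 * e2 ^ 5 * t ^ 2 + 12 * e2 ^ 6 := by
  rw [V_P12]; simp only [P_0, P_1 h, P_2 h, P_3 h, P_4 h, P_5 h, P_6 h, P_7 h, P_8 h, P_9 h, P_10 h, P_11 h, P_12 h]; ring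

/-- Coefficient of `x ^ 0` in the reduced derivative. -/
def dc0 (e2 e3 e4 e5 e6 t : ℚ) : ℚ :=
    -18 * t ^ 8 + 504 * e6 * t ^ 2 + 36 * e4 ^ 2 + 72 * e3 * e5 - 1692 * e2 * e6 - 72 * e2 * e3 ^ 2
      - 72 * e2 ^ 2 * e4 + 18 * e2 ^ 4 + 0 * (e2 + e3 + e4 + e5 + e6 + t)

/-- Coefficient of `x ^ 1` in the reduced derivative. -/
def dc1 (e2 e3 e4 e5 e6 t : ℚ) : ℚ :=
    -504 * e5 * t ^ 2 - 504 * e3 * e4 + 1260 * e2 * e5 + 504 * e2 ^ 2 * e3 + 0 * (e2 + e3 + e4 + e5 + e6 + t)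

/-- Coefficient of `x ^ 2` in the reduced derivative. -/
def dc2 (e2 e3 e4 e5 e6 t : ℚ) : ℚ :=
    -504 * t ^ 6 + 756 * e6 + 504 * e4 * t ^ 2 + 756 * e3 ^ 2 - 252 * e2 * e4 - 504 * e2 ^ 3 + 0 * (e2 + e3 + e4 + e5 + e6 + t)

/-- Coefficient of `x ^ 3` in the reduced derivative. -/
def dc3 (e2 e3 e4 e5 e6 t : ℚ) : ℚ :=
    252 * e5 - 504 * e3 * t ^ 2 - 756 * e2 * e3 + 0 * (e2 + e3 + e4 + e5 + e6 + t)

/-- Coefficient of `x ^ 4` in the reduced derivative. -/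
def dc4 (e2 e3 e4 e5 e6 t : ℚ) : ℚ :=
    -1260 * t ^ 4 - 252 * e4 + 504 * e2 * t ^ 2 - 504 * e2 ^ 2 + 0 * (e2 + e3 + e4 + e5 + e6 + t)

/-- Coefficient of `x ^ 5` in the reduced derivative. -/
def dc5 (e2 e3 e4 e5 e6 t : ℚ) : ℚ :=
    -756 * e3 + 0 * (e2 + e3 + e4 + e5 + e6 + t)

lemma Dx_P (x a b c d e t : ℚ) : Dx x a b c d e t = 9 * (-(t - x) ^ 8 - (-t - x) ^ 8 - 256 * x ^ 8 +
      1 * (x ^ 8 * P x a b c d e 0) + 8 * (x ^ 7 * P x a b c d e 1) + 28 * (x ^ 6 * P x a b c d e 2) + 56 * (x ^ 5 * P x a b c d e 3) + 70 * (x ^ 4 * P x a b c d e 4) + 56 * (x ^ 3 * P x a b c d e 5) + 28 * (x ^ 2 * P x a b c d e 6) + 8 * (x ^ 1 * P x a b c d e 7) + 1 * (x ^ 0 * P x a b c d e 8)) := by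
  simp only [Dx, P]; ring

lemma Dx_red (x : ℚ) {a b c d e f e2 e3 e4 e5 e6 : ℚ} (h : IsEl a b c d e f e2 e3 e4 e5 e6)
    (hx : x ^ 6 + e2 * x ^ 4 - e3 * x ^ 3 + e4 * x ^ 2 - e5 * x + e6 = 0) (t : ℚ) :
    9 * (-(t - x) ^ 8 - (-t - x) ^ 8 - 256 * x ^ 8 +
      1 * (x ^ 8 * P a b c d e f 0) + 8 * (x ^ 7 * P a b c d e f 1) + 28 * (x ^ 6 * P a b c d e f 2) + 56 * (x ^ 5 * P a b c d e f 3) + 70 * (x ^ 4 * P a b c d e f 4) + 56 * (x ^ 3 * P a b c d e f 5) + 28 * (x ^ 2 * P a b c d e f 6) + 8 * (x ^ 1 * P a b c d e f 7) + 1 * (x ^ 0 * P a b c d e f 8)) =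
    dc0 e2 e3 e4 e5 e6 t * x ^ 0 + dc1 e2 e3 e4 e5 e6 t * x ^ 1 + dc2 e2 e3 e4 e5 e6 t * x ^ 2 + dc3 e2 e3 e4 e5 e6 t * x ^ 3 + dc4 e2 e3 e4 e5 e6 t * x ^ 4 + dc5 e2 e3 e4 e5 e6 t * x ^ 5 := by
  simp only [P_0, P_1 h, P_2 h, P_3 h, P_4 h, P_5 h, P_6 h, P_7 h, P_8 h]
  simp only [dc0, dc1, dc2, dc3, dc4, dc5]
  linear_combination ((-2268) * x ^ 2 + (0) * x ^ 1 + (-504 * t ^ 2 + 1764 * e2) * x ^ 0) * hx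

lemma Dx_a {a b c d e f e2 e3 e4 e5 e6 : ℚ} (h : IsEl a b c d e f e2 e3 e4 e5 e6) (t : ℚ) :
    Dx a b c d e f t = dc0 e2 e3 e4 e5 e6 t * a ^ 0 + dc1 e2 e3 e4 e5 e6 t * a ^ 1 + dc2 e2 e3 e4 e5 e6 t * a ^ 2 + dc3 e2 e3 e4 e5 e6 t * a ^ 3 + dc4 e2 e3 e4 e5 e6 t * a ^ 4 + dc5 e2 e3 e4 e5 e6 t * a ^ 5 := by
  rw [← Dx_red a h ((poly_root h a).trans (by ring)), Dx_P]

lemma Dx_b {a b c d e f e2 e3 e4 e5 e6 : ℚ} (h : IsEl a b c d e f e2 e3 e4 e5 e6) (t : ℚ) :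
    Dx b a c d e f t = dc0 e2 e3 e4 e5 e6 t * b ^ 0 + dc1 e2 e3 e4 e5 e6 t * b ^ 1 + dc2 e2 e3 e4 e5 e6 t * b ^ 2 + dc3 e2 e3 e4 e5 e6 t * b ^ 3 + dc4 e2 e3 e4 e5 e6 t * b ^ 4 + dc5 e2 e3 e4 e5 e6 t * b ^ 5 := by
  rw [← Dx_red b h ((poly_root h b).trans (by ring)), Dx_P]
  have hP : ∀ k, P b a c d e f k = P a b c d e f k := by intro k; simp only [P]; ring
  simp only [hP]

lemma Dx_c {a b c d e f e2 e3 e4 e5 e6 : ℚ} (h : IsEl a b c d e f e2 e3 e4 e5 e6) (t : ℚ) :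
    Dx c a b d e f t = dc0 e2 e3 e4 e5 e6 t * c ^ 0 + dc1 e2 e3 e4 e5 e6 t * c ^ 1 + dc2 e2 e3 e4 e5 e6 t * c ^ 2 + dc3 e2 e3 e4 e5 e6 t * c ^ 3 + dc4 e2 e3 e4 e5 e6 t * c ^ 4 + dc5 e2 e3 e4 e5 e6 t * c ^ 5 := by
  rw [← Dx_red c h ((poly_root h c).trans (by ring)), Dx_P]
  have hP : ∀ k, P c a b d e f k = P a b c d e f k := by intro k; simp only [P]; ring
  simp only [hP]

lemma Dx_d {a b c d e f e2 e3 e4 e5 e6 : ℚ} (h : IsEl a b c d e f e2 e3 e4 e5 e6) (t : ℚ) :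
    Dx d a b c e f t = dc0 e2 e3 e4 e5 e6 t * d ^ 0 + dc1 e2 e3 e4 e5 e6 t * d ^ 1 + dc2 e2 e3 e4 e5 e6 t * d ^ 2 + dc3 e2 e3 e4 e5 e6 t * d ^ 3 + dc4 e2 e3 e4 e5 e6 t * d ^ 4 + dc5 e2 e3 e4 e5 e6 t * d ^ 5 := by
  rw [← Dx_red d h ((poly_root h d).trans (by ring)), Dx_P]
  have hP : ∀ k, P d a b c e f k = P a b c d e f k := by intro k; simp only [P]; ring
  simp only [hP]

lemma Dx_e {a b c d e f e2 e3 e4 e5 e6 : ℚ} (h : IsEl a b c d e f e2 e3 e4 e5 e6) (t : ℚ) :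
    Dx e a b c d f t = dc0 e2 e3 e4 e5 e6 t * e ^ 0 + dc1 e2 e3 e4 e5 e6 t * e ^ 1 + dc2 e2 e3 e4 e5 e6 t * e ^ 2 + dc3 e2 e3 e4 e5 e6 t * e ^ 3 + dc4 e2 e3 e4 e5 e6 t * e ^ 4 + dc5 e2 e3 e4 e5 e6 t * e ^ 5 := by
  rw [← Dx_red e h ((poly_root h e).trans (by ring)), Dx_P]
  have hP : ∀ k, P e a b c d f k = P a b c d e f k := by intro k; simp only [P]; ring
  simp only [hP]

lemma Dx_f {a b c d e f e2 e3 e4 e5 e6 : ℚ} (h : IsEl a b c d e f e2 e3 e4 e5 e6) (t : ℚ) :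
    Dx f a b c d e t = dc0 e2 e3 e4 e5 e6 t * f ^ 0 + dc1 e2 e3 e4 e5 e6 t * f ^ 1 + dc2 e2 e3 e4 e5 e6 t * f ^ 2 + dc3 e2 e3 e4 e5 e6 t * f ^ 3 + dc4 e2 e3 e4 e5 e6 t * f ^ 4 + dc5 e2 e3 e4 e5 e6 t * f ^ 5 := by
  rw [← Dx_red f h ((poly_root h f).trans (by ring)), Dx_P]
  have hP : ∀ k, P f a b c d e k = P a b c d e f k := by intro k; simp only [P]; ring
  simp only [hP]

lemma Dt_val {a b c d e f e2 e3 e4 e5 e6 : ℚ} (h : IsEl a b c d e f e2 e3 e4 e5 e6) (t : ℚ) :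
    Dt a b c d e f t =
      -5040 * e5 * t ^ 3 - 3024 * e3 * t ^ 5 + 1008 * e3 * e4 * t + 1008 * e2 * e5 * t + 5040 * e2 * e3 * t ^ 3
      - 1008 * e2 ^ 2 * e3 * t := by
  have h0 : Dt a b c d e f t = -144 * (t ^ 7 * P a b c d e f 1 + 7 * t ^ 5 * P a b c d e f 3 +
      7 * t ^ 3 * P a b c d e f 5 + t * P a b c d e f 7) := by
    simp only [Dt, P]; ring
  rw [h0, P_1 h, P_3 h, P_5 h, P_7 h]; ring

lemma sum_D (a b c d e f e2 e3 e4 e5 e6 : ℚ) (t : ℚ) :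
    (dc0 e2 e3 e4 e5 e6 t * a ^ 0 + dc1 e2 e3 e4 e5 e6 t * a ^ 1 + dc2 e2 e3 e4 e5 e6 t * a ^ 2 + dc3 e2 e3 e4 e5 e6 t * a ^ 3 + dc4 e2 e3 e4 e5 e6 t * a ^ 4 + dc5 e2 e3 e4 e5 e6 t * a ^ 5) + (dc0 e2 e3 e4 e5 e6 t * b ^ 0 + dc1 e2 e3 e4 e5 e6 t * b ^ 1 + dc2 e2 e3 e4 e5 e6 t * b ^ 2 + dc3 e2 e3 e4 e5 e6 t * b ^ 3 + dc4 e2 e3 e4 e5 e6 t * b ^ 4 + dc5 e2 e3 e4 e5 e6 t * b ^ 5) + (dc0 e2 e3 e4 e5 e6 t * c ^ 0 + dc1 e2 e3 e4 e5 e6 t * c ^ 1 + dc2 e2 e3 e4 e5 e6 t * c ^ 2 + dc3 e2 e3 e4 e5 e6 t * c ^ 3 + dc4 e2 e3 e4 e5 e6 t * c ^ 4 + dc5 e2 e3 e4 e5 e6 t * c ^ 5) + (dc0 e2 e3 e4 e5 e6 t * d ^ 0 + dc1 e2 e3 e4 e5 e6 t * d ^ 1 + dc2 e2 e3 e4 e5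 e6 t * d ^ 2 + dc3 e2 e3 e4 e5 e6 t * d ^ 3 + dc4 e2 e3 e4 e5 e6 t * d ^ 4 + dc5 e2 e3 e4 e5 e6 t * d ^ 5) + (dc0 e2 e3 e4 e5 e6 t * e ^ 0 + dc1 e2 e3 e4 e5 e6 t * e ^ 1 + dc2 e2 e3 e4 e5 e6 t * e ^ 2 + dc3 e2 e3 e4 e5 e6 t * e ^ 3 + dc4 e2 e3 e4 e5 e6 t * e ^ 4 + dc5 e2 e3 e4 e5 e6 t * e ^ 5) + (dc0 e2 e3 e4 e5 e6 t * f ^ 0 + dc1 e2 e3 e4 e5 e6 t * f ^ 1 + dc2 e2 e3 e4 e5 e6 t * f ^ 2 + dc3 e2 e3 e4 e5 e6 t * f ^ 3 + dc4 e2 e3 e4 e5 e6 t * f ^ 4 + dc5 e2 e3 e4 e5 e6 t * f ^ 5) =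
    dc0 e2 e3 e4 e5 e6 t * P a b c d e f 0 + dc1 e2 e3 e4 e5 e6 t * P a b c d e f 1 + dc2 e2 e3 e4 e5 e6 t * P a b c d e f 2 + dc3 e2 e3 e4 e5 e6 t * P a b c d e f 3 + dc4 e2 e3 e4 e5 e6 t * P a b c d e f 4 + dc5 e2 e3 e4 e5 e6 t * P a b c d e f 5 := by
  simp only [P]
  generalize dc0 e2 e3 e4 e5 e6 t = s0
  generalize dc1 e2 e3 e4 e5 e6 t = s1
  generalize dc2 e2 e3 e4 e5 e6 t = s2
  generalize dc3 e2 e3 e4 e5 e6 t = s3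
  generalize dc4 e2 e3 e4 e5 e6 t = s4
  generalize dc5 e2 e3 e4 e5 e6 t = s5
  ring

lemma sum_D_sq (a b c d e f e2 e3 e4 e5 e6 : ℚ) (t : ℚ) :
    (dc0 e2 e3 e4 e5 e6 t * a ^ 0 + dc1 e2 e3 e4 e5 e6 t * a ^ 1 + dc2 e2 e3 e4 e5 e6 t * a ^ 2 + dc3 e2 e3 e4 e5 e6 t * a ^ 3 + dc4 e2 e3 e4 e5 e6 t * a ^ 4 + dc5 e2 e3 e4 e5 e6 t * a ^ 5) ^ 2 + (dc0 e2 e3 e4 e5 e6 t * b ^ 0 + dc1 e2 e3 e4 e5 e6 t * b ^ 1 + dc2 e2 e3 e4 e5 e6 t * b ^ 2 + dc3 e2 e3 e4 e5 e6 t * b ^ 3 + dc4 e2 e3 e4 e5 e6 t * b ^ 4 + dc5 e2 e3 e4 e5 e6 t * b ^ 5) ^ 2 + (dc0 e2 e3 e4 e5 e6 t * c ^ 0 + dc1 e2 e3 e4 e5 e6 t * c ^ 1 + dc2 e2 e3 e4 e5 e6 t * c ^ 2 + dc3 e2 e3 e4 e5 e6 t * c ^ 3 + dc4 e2 e3 e4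 e5 e6 t * c ^ 4 + dc5 e2 e3 e4 e5 e6 t * c ^ 5) ^ 2 + (dc0 e2 e3 e4 e5 e6 t * d ^ 0 + dc1 e2 e3 e4 e5 e6 t * d ^ 1 + dc2 e2 e3 e4 e5 e6 t * d ^ 2 + dc3 e2 e3 e4 e5 e6 t * d ^ 3 + dc4 e2 e3 e4 e5 e6 t * d ^ 4 + dc5 e2 e3 e4 e5 e6 t * d ^ 5) ^ 2 + (dc0 e2 e3 e4 e5 e6 t * e ^ 0 + dc1 e2 e3 e4 e5 e6 t * e ^ 1 + dc2 e2 e3 e4 e5 e6 t * e ^ 2 + dc3 e2 e3 e4 e5 e6 t * e ^ 3 + dc4 e2 e3 e4 e5 e6 t * e ^ 4 + dc5 e2 e3 e4 e5 e6 t * e ^ 5) ^ 2 + (dc0 e2 e3 e4 e5 e6 t * f ^ 0 + dc1 e2 e3 e4 e5 e6 t * f ^ 1 + dc2 e2 e3 e4 e5 e6 t * f ^ 2 + dc3 e2 e3 e4 e5 e6 t * f ^ 3 + dc4 e2 e3 e4 e5 e6 t * f ^ 4 + dc5 e2 e3 e4 e5 e6 t * f ^ 5) ^ 2 =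
    1 * (dc0 e2 e3 e4 e5 e6 t * dc0 e2 e3 e4 e5 e6 t * P a b c d e f 0) + 2 * (dc0 e2 e3 e4 e5 e6 t * dc1 e2 e3 e4 e5 e6 t * P a b c d e f 1) + 2 * (dc0 e2 e3 e4 e5 e6 t * dc2 e2 e3 e4 e5 e6 t * P a b c d e f 2) + 2 * (dc0 e2 e3 e4 e5 e6 t * dc3 e2 e3 e4 e5 e6 t * P a b c d e f 3) + 2 * (dc0 e2 e3 e4 e5 e6 t * dc4 e2 e3 e4 e5 e6 t * P a b c d e f 4) + 2 * (dc0 e2 e3 e4 e5 e6 t * dc5 e2 e3 e4 e5 e6 t * P a b c d e f 5) + 1 * (dc1 e2 e3 e4 e5 e6 t * dc1 e2 e3 e4 e5 e6 t * P a b c d e f 2) + 2 * (dc1 e2 e3 e4 e5 e6 t * dc2 e2 e3 e4 e5 e6 t * P a b c d e f 3) + 2 * (dc1 e2 e3 e4 e5 e6 t * dc3 e2 e3 e4 e5 e6 t * P a b c d e f 4) + 2 * (dc1 e2 e3 e4 e5 e6 t * dc4 e2 e3 e4 e5 e6 t * P a b c d e f 5) + 2 * (dc1 e2 e3 e4 e5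 e6 t * dc5 e2 e3 e4 e5 e6 t * P a b c d e f 6) + 1 * (dc2 e2 e3 e4 e5 e6 t * dc2 e2 e3 e4 e5 e6 t * P a b c d e f 4) + 2 * (dc2 e2 e3 e4 e5 e6 t * dc3 e2 e3 e4 e5 e6 t * P a b c d e f 5) + 2 * (dc2 e2 e3 e4 e5 e6 t * dc4 e2 e3 e4 e5 e6 t * P a b c d e f 6) + 2 * (dc2 e2 e3 e4 e5 e6 t * dc5 e2 e3 e4 e5 e6 t * P a b c d e f 7) + 1 * (dc3 e2 e3 e4 e5 e6 t * dc3 e2 e3 e4 e5 e6 t * P a b c d e f 6) + 2 * (dc3 e2 e3 e4 e5 e6 t * dc4 e2 e3 e4 e5 e6 t * P a b c d e f 7) + 2 * (dc3 e2 e3 e4 e5 e6 t * dc5 e2 e3 e4 e5 e6 t * P a b c d e f 8) + 1 * (dc4 e2 e3 e4 e5 e6 t * dc4 e2 e3 e4 e5 e6 t * P a b c d e f 8) + 2 * (dc4 e2 e3 e4 e5 e6 t * dc5 e2 e3 e4 e5 e6 t * P a b c d e f 9) + 1 * (dc5 e2 e3 e4 e5 e6 t * dc5 e2 e3 e4 e5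 e6 t * P a b c d e f 10) := by
  simp only [P]
  generalize dc0 e2 e3 e4 e5 e6 t = s0
  generalize dc1 e2 e3 e4 e5 e6 t = s1
  generalize dc2 e2 e3 e4 e5 e6 t = s2
  generalize dc3 e2 e3 e4 e5 e6 t = s3
  generalize dc4 e2 e3 e4 e5 e6 t = s4
  generalize dc5 e2 e3 e4 e5 e6 t = s5
  ring

set_option maxHeartbeats 4000000 in
lemma main_id {a b c d e f e2 e3 e4 e5 e6 : ℚ} (h : IsEl a b c d e f e2 e3 e4 e5 e6) (t u2 : ℚ)
    (hu : u2 = t ^ 2 + 1 / 2 * P a b c d e f 2) :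
    2 * ((Dx a b c d e f t) ^ 2 + (Dx b a c d e f t) ^ 2 + (Dx c a b d e f t) ^ 2 + (Dx d a b c e f t) ^ 2 + (Dx e a b c d f t) ^ 2 + (Dx f a b c d e t) ^ 2) -
      (Dx a b c d e f t + Dx b a c d e f t + Dx c a b d e f t + Dx d a b c e f t + Dx e a b c d f t + Dx f a b c d e t) ^ 2 / 3 + (Dt a b c d e f t) ^ 2 =
    14112/5 * V a b c d e f t 12 * u2 ^ 2 + 3192/5 * V a b c d e f t 9 * V a b c d e f t 5 * u2 +
        1323/50 * V a b c d e f t 8 ^ 2 - 3528/25 * V a b c d e f t 8 * V a b c d e f t 6 * u2 -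
        128772/5 * V a b c d e f t 8 * u2 ^ 4 + 784/25 * V a b c d e f t 6 ^ 2 * u2 ^ 2 +
        147/25 * V a b c d e f t 6 * V a b c d e f t 5 ^ 2 + 249312/5 * V a b c d e f t 6 * u2 ^ 5 -
        4116 * V a b c d e f t 5 ^ 2 * u2 ^ 3 - 1555848/5 * u2 ^ 8 := by
  rw [Dx_a h, Dx_b h, Dx_c h, Dx_d h, Dx_e h, Dx_f h, Dt_val h, V_5 h, V_6 h, V_8 h, V_9 h, V_12 h]
  have k1 := sum_D a b c d e f e2 e3 e4 e5 e6 t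
  have k2 := sum_D_sq a b c d e f e2 e3 e4 e5 e6 t
  rw [P_0, P_1 h, P_2 h, P_3 h, P_4 h, P_5 h] at k1
  simp only [P_0, P_1 h, P_2 h, P_3 h, P_4 h, P_5 h, P_6 h, P_7 h, P_8 h, P_9 h, P_10 h] at k2
  rw [k2, k1, hu, P_2 h]
  simp only [dc0, dc1, dc2, dc3, dc4, dc5]
  ring

/-- `⟨du₉, du₉⟩* = (14112/5) u₁₂ u₂² + (3192/5) u₉ u₅ u₂ + (1323/50) u₈² -
(3528/25) u₈ u₆ u₂ - (128772/5) u₈ u₂⁴ + (784/25) u₆² u₂² + (147/25) u₆ u₅² +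
(249312/5) u₆ u₂⁵ - 4116 u₅² u₂³ - (1555848/5) u₂⁸`. -/
theorem E6_pair_u9_u9 :
    pairE6 (u 9) (u 9) =
      C (14112/5 : ℚ) * u 12 * u 2 ^ 2 + C (3192/5 : ℚ) * u 9 * u 5 * u 2 +
        C (1323/50 : ℚ) * u 8 ^ 2 - C (3528/25 : ℚ) * u 8 * u 6 * u 2 -
        C (128772/5 : ℚ) * u 8 * u 2 ^ 4 + C (784/25 : ℚ) * u 6 ^ 2 * u 2 ^ 2 +
        C (147/25 : ℚ) * u 6 * u 5 ^ 2 + C (249312/5 : ℚ) * u 6 * u 2 ^ 5 -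
        C (4116 : ℚ) * u 5 ^ 2 * u 2 ^ 3 - C (1555848/5 : ℚ) * u 2 ^ 8 := by
  apply MvPolynomial.funext
  intro y
  rw [eval_pair y (u 9) _ _ _ _ _ _ _
    (by rw [pd0, map_sub, eval_Dx, eval_Dx]) (by rw [pd1, map_sub, eval_Dx, eval_Dx])
    (by rw [pd2, map_sub, eval_Dx, eval_Dx]) (by rw [pd3, map_sub, eval_Dx, eval_Dx])
    (by rw [pd4, map_sub, eval_Dx, eval_Dx]) (by rw [pd5, eval_Dt])]
  simp only [map_add, map_sub, map_mul, map_pow, eval_C, eval_u y 12 (by norm_num),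
    eval_u y 9 (by norm_num), eval_u y 8 (by norm_num), eval_u y 6 (by norm_num),
    eval_u y 5 (by norm_num), eval_X, map_neg]
  have hsum : y 0 + y 1 + y 2 + y 3 + y 4 + -(y 0 + y 1 + y 2 + y 3 + y 4) = 0 := by ring
  have hu := eval_u_two y
  generalize -(y 0 + y 1 + y 2 + y 3 + y 4) = z at *
  exact main_id (a := y 0) (b := y 1) (c := y 2) (d := y 3) (e := y 4) (f := z)
    ⟨hsum, rfl, rfl, rfl, rfl, rfl⟩ (y 5) (eval y (u 2)) hu
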